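/- arXiv:1210.0845 — 2 statements merged into one kernel-verified Lean document; each statement's English description precedes it below -/
import Mathlib

section
/- Let n ≥ 2, let i, j ∈ [n] be distinct, and let y be a function assigning to each simple path p from i to j in K_n a real number y_p, satisfying: (a) for every r ≥ 3 and all pairwise distinct i₁,…,i_r ∈ [n] ∖ {i,j}, y_{(i,i₁,…,i_r,j)} = (1/2)·( y_{(i,i₁,i_r,j)} − y_{(i,i_r,i₁,j)} + ∑_{s=1}^{r−1} ( y_{(i,i_s,i_{s+1},j)} + y_{(i,i_{s+1},i_s,j)} ) ) − ∑_{s=2}^{r−1} y_{(i,i_s,j)}; and (b) for all pairwise distinct l, o, m ∈ [n] ∖ {i,j}, y_{(i,m,l,j)} + y_{(i,o,m,j)} + y_{(i,l,o,j)} = y_{(i,l,m,j)} + y_{(i,m,o,j)} + y_{(i,o,l,j)}. Then there exists an edge-weight function w on K_n (a real weight on each 2-element subset of [n]) such that for every simple path p from i to j, the weight w(p) of p equals y_p. -/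
/-- The weight of a path, given as the list of its vertices: the sum of the weights of
consecutive pairs of vertices. -/
def pathWeight {n : ℕ} (w : Fin n → Fin n → ℝ) : List (Fin n) → ℝ
  | a :: b :: rest => w a b + pathWeight w (b :: rest)
  | _ => 0

/-- `p` is (the vertex list of) a simple path between `i` and `j`: its vertices are pairwise
distinct, it starts at `i` and ends at `j`. -/
def IsPath {n : ℕ} (i j : Fin n) (p : List (Fin n)) : Prop :=
  p.Nodup ∧ p.head? = some i ∧ p.getLast? = some j

/-- `Nn n = ∑_{k=1}^{n-1} (n-2)!/(n-1-k)!`, the number of simple paths between two fixed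
distinct vertices of the complete graph `K_n`. -/
def Nn (n : ℕ) : ℕ := ∑ k ∈ Finset.Icc 1 (n - 1), Nat.factorial (n - 2) / Nat.factorial (n - 1 - k)

noncomputable instance {n : ℕ} (i j : Fin n) : Fintype {p : List (Fin n) // IsPath i j p} :=
  Fintype.ofInjective (fun p => (⟨p.1, p.2.1⟩ : {l : List (Fin n) // l.Nodup}))
    (by intro p q h; cases p; cases q; simpa [Subtype.ext_iff] using h)

/-- The finite set of (vertex lists of) simple paths between `i` and `j` in `K_n`. -/
noncomputable def pathFinset (n : ℕ) (i j : Fin n) : Finset (List (Fin n)) :=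
  (Finset.univ : Finset {p : List (Fin n) // IsPath i j p}).map
    ⟨Subtype.val, Subtype.val_injective⟩

/-- `DG n w i j` is the multiset of the weights of all simple paths between `i` and `j`. -/
noncomputable def DG (n : ℕ) (w : Fin n → Fin n → ℝ) (i j : Fin n) : Multiset ℝ :=
  (pathFinset n i j).val.map (pathWeight w)

/-- `hMultiset n y u v` is the multiset of all sums
`y u i₁ + y i₁ i₂ + ⋯ + y i_{r-1} i_r + y i_r v` over `r ≥ 0` and pairwise distinct
`i₁, …, i_r ∈ [n] ∖ {u,v}`. -/
noncomputable def hMultiset (n : ℕ) (y : Fin n → Fin n → ℝ) (u v : Fin n) : Multiset ℝ :=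
  (pathFinset n u v).val.map (pathWeight y)

theorem pathWeight_map_range {n : ℕ} (w : Fin n → Fin n → ℝ) (j : Fin n) (r : ℕ)
    (e : ℕ → Fin n) :
    pathWeight w ((List.range (r + 1)).map e ++ [j]) =
      ∑ s ∈ Finset.range r, w (e s) (e (s + 1)) + w (e r) j := by
  induction r generalizing e with
  | zero => simp [pathWeight]
  | succ r ih =>
    have h := ih (e ∘ Nat.succ)
    rw [List.range_succ_eq_map] at h ⊢
    rw [List.range_succ_eq_map, Finset.sum_range_succ']
    simp only [List.map_cons, List.map_map, List.cons_append, pathWeight, Function.comp_def,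
      Nat.succ_eq_add_one, Nat.zero_add] at h ⊢
    rw [h]
    ring

theorem sum_range_add_succ_eq (f : ℕ → ℝ) (r : ℕ) :
    ∑ s ∈ Finset.range (r + 1), (f s + f (s + 1)) =
      f 0 + f (r + 1) + 2 * ∑ s ∈ Finset.Icc 1 r, f s := by
  induction r with
  | zero => simp
  | succ r ih =>
    rw [Finset.sum_range_succ, ih, Finset.sum_Icc_succ_top (by omega)]
    ring

theorem IsPath.exists_eq_cons_append {n : ℕ} {i j : Fin n} (hij : i ≠ j) {p : List (Fin n)}
    (hp : IsPath i j p) :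
    ∃ t : List (Fin n), p = i :: (t ++ [j]) ∧ t.Nodup ∧ ∀ x ∈ t, x ≠ i ∧ x ≠ j := by
  obtain ⟨hnd, hhead, hlast⟩ := hp
  obtain ⟨q, rfl⟩ := List.head?_eq_some_iff.1 hhead
  rcases List.eq_nil_or_concat q with rfl | ⟨t, b, rfl⟩
  · simp at hlast
    exact absurd hlast hij
  · have hb : b = j := by
      rw [List.concat_eq_append, ← List.cons_append, List.getLast?_append] at hlast
      simpa using hlast
    subst hb
    rw [List.concat_eq_append] at hnd
    refine ⟨t, by simp, ?_, ?_⟩ <;> grind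

/-- If the antisymmetrization of `g` is a cocycle on the distinct elements of `V`, then it is a
coboundary on `V`. -/
theorem exists_sub_eq_sub_of_cocycle {α : Type*} (V : Set α) (g : α → α → ℝ)
    (hg : ∀ l ∈ V, ∀ o ∈ V, ∀ m ∈ V, l ≠ o → l ≠ m → o ≠ m →
      g m l + g o m + g l o = g l m + g m o + g o l) :
    ∃ d : α → ℝ, ∀ l ∈ V, ∀ m ∈ V, g l m - g m l = d l - d m := by
  rcases V.eq_empty_or_nonempty with rfl | ⟨o, ho⟩
  · exact ⟨0, by simp⟩
  · refine ⟨fun l => g l o - g o l, fun l hl m hm => ?_⟩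
    by_cases hlm : l = m
    · subst hlm; ring
    by_cases hlo : l = o
    · subst hlo; ring
    by_cases hmo : m = o
    · subst hmo; ring
    linarith [hg l hl o ho m hm hlo hlm (Ne.symm hmo)]

/-- A symmetric weight with prescribed value `c` on `{i, j}`, values `a` on the other edges at `i`,
values `b` on the other edges at `j`, and values `g` on the remaining edges. -/
theorem exists_symmetric_weight {α : Type*} {i j : α} (hij : i ≠ j) (c : ℝ) (a b : α → ℝ)
    (g : α → α → ℝ) (hg : ∀ l m, g l m = g m l) :
    ∃ w : α → α → ℝ, (∀ l m, w l m = w m l) ∧ w i j = c ∧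
      (∀ l, l ≠ i → l ≠ j → w i l = a l ∧ w l j = b l) ∧
      ∀ l m, l ≠ i → l ≠ j → m ≠ i → m ≠ j → w l m = g l m := by
  classical
  refine ⟨fun u v =>
    if (u = i ∧ v = j) ∨ (u = j ∧ v = i) then c
    else if u = i then a v else if v = i then a u
    else if u = j then b v else if v = j then b u else g u v, ?_, ?_, ?_, ?_⟩
  · intro l m
    have := hg l m
    grind
  · simp
  · intro l hi hj
    grind
  · intro l m h1 h2 h3 h4
    simp [h1, h2, h3, h4]

/-- If `y` assigns a real number to each simple path from `i` to `j` and satisfies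
conditions (a) and (b), then there is an edge-weight function `w` on `K_n` such that the weight
of every simple path `p` from `i` to `j` equals `y p`. -/
theorem stmt_7 (n : ℕ) (hn : 2 ≤ n) (i j : Fin n) (hij : i ≠ j)
    (y : List (Fin n) → ℝ)
    (ha : ∀ r : ℕ, 3 ≤ r → ∀ e : ℕ → Fin n,
      (∀ s < r, ∀ t < r, e s = e t → s = t) → (∀ s < r, e s ≠ i ∧ e s ≠ j) →
      y ([i] ++ (List.range r).map e ++ [j]) =
        (1 / 2) * (y [i, e 0, e (r - 1), j] - y [i, e (r - 1), e 0, j]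
          + ∑ s ∈ Finset.range (r - 1),
              (y [i, e s, e (s + 1), j] + y [i, e (s + 1), e s, j]))
        - ∑ s ∈ Finset.Icc 1 (r - 2), y [i, e s, j])
    (hb : ∀ l o m : Fin n, l ≠ i → l ≠ j → o ≠ i → o ≠ j → m ≠ i → m ≠ j →
      l ≠ o → l ≠ m → o ≠ m →
      y [i, m, l, j] + y [i, o, m, j] + y [i, l, o, j]
        = y [i, l, m, j] + y [i, m, o, j] + y [i, o, l, j]) :
    ∃ w : Fin n → Fin n → ℝ, (∀ a b, w a b = w b a) ∧
      ∀ p : List (Fin n), IsPath i j p → pathWeight w p = y p := by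
  obtain ⟨d, hd⟩ := exists_sub_eq_sub_of_cocycle {l | l ≠ i ∧ l ≠ j} (fun l m => y [i, l, m, j])
    (fun l hl o ho m hm => hb l o m hl.1 hl.2 ho.1 ho.2 hm.1 hm.2)
  obtain ⟨w, hsymm, hwij, hwa, hwg⟩ := exists_symmetric_weight hij (y [i, j])
    (fun l => (y [i, l, j] + d l) / 2) (fun l => (y [i, l, j] - d l) / 2)
    (fun l m => (y [i, l, m, j] + y [i, m, l, j] - y [i, l, j] - y [i, m, j]) / 2)
    (fun l m => by ring)
  refine ⟨w, hsymm, fun p hp => ?_⟩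
  obtain ⟨t, rfl, hnd, ht⟩ := hp.exists_eq_cons_append hij
  match t, hnd, ht with
  | [], _, _ => simp [pathWeight, hwij]
  | [l], _, ht =>
    have hl := ht l (by simp)
    have hw := hwa l hl.1 hl.2
    simp only [List.cons_append, List.nil_append, pathWeight, hw]
    ring
  | [l, m], _, ht =>
    have hl := ht l (by simp)
    have hm := ht m (by simp)
    have hlm := hd l hl m hm
    simp only [List.cons_append, List.nil_append, pathWeight, hwa l hl.1 hl.2, hwa m hm.1 hm.2,
      hwg l m hl.1 hl.2 hm.1 hm.2]
    linarith
  | l₁ :: l₂ :: l₃ :: t', hnd, ht =>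
    set t := l₁ :: l₂ :: l₃ :: t' with ht_def
    obtain ⟨r, hr⟩ : ∃ r, t.length = r + 1 + 1 + 1 := ⟨t'.length, by simp [ht_def]⟩
    clear_value t
    let e : ℕ → Fin n := fun s => t.getD s i
    have he : ∀ s < r + 1 + 1 + 1, ∃ h : s < t.length, e s = t[s] := fun s hs =>
      ⟨hr ▸ hs, by simp [e, hr, hs]⟩
    have hmap : t = (List.range (r + 1 + 1 + 1)).map e := by
      apply List.ext_getElem
      · simp [hr]
      · intro s h₁ h₂
        obtain ⟨_, h⟩ := he s (hr ▸ h₁)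
        simp [h]
    have hV : ∀ s < r + 1 + 1 + 1, e s ≠ i ∧ e s ≠ j := fun s hs => by
      obtain ⟨_, h⟩ := he s hs
      rw [h]
      exact ht _ (List.getElem_mem _)
    have hinj : ∀ s < r + 1 + 1 + 1, ∀ u < r + 1 + 1 + 1, e s = e u → s = u := by
      intro s hs u hu h
      obtain ⟨_, h₁⟩ := he s hs
      obtain ⟨_, h₂⟩ := he u hu
      rw [h₁, h₂] at h
      exact (hnd.getElem_inj_iff).1 h
    have hy := ha (r + 1 + 1 + 1) (by omega) e hinj hV
    have hpw := pathWeight_map_range w j (r + 1 + 1) e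
    have hcons : pathWeight w (i :: (t ++ [j])) = w i (e 0) + pathWeight w (t ++ [j]) := by
      rw [hmap, List.range_succ_eq_map]
      simp only [List.map_cons, List.cons_append, pathWeight]
    have hsum : ∑ s ∈ Finset.range (r + 1 + 1), w (e s) (e (s + 1)) =
        (1 / 2) * (∑ s ∈ Finset.range (r + 1 + 1),
            (y [i, e s, e (s + 1), j] + y [i, e (s + 1), e s, j])
          - ∑ s ∈ Finset.range (r + 1 + 1), (y [i, e s, j] + y [i, e (s + 1), j])) := by
      rw [← Finset.sum_sub_distrib, Finset.mul_sum]
      refine Finset.sum_congr rfl fun s hs => ?_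
      have hs := Finset.mem_range.1 hs
      have h₁ := hV s (by omega)
      have h₂ := hV (s + 1) (by omega)
      rw [hwg _ _ h₁.1 h₁.2 h₂.1 h₂.2]
      ring
    have h₀ := hV 0 (by omega)
    have h₁ := hV (r + 1 + 1) (by omega)
    have hd' := hd _ h₀ _ h₁
    rw [sum_range_add_succ_eq (fun s => y [i, e s, j])] at hsum
    rw [← hmap] at hy hpw
    simp only [Nat.add_sub_cancel, show r + 1 + 1 + 1 - 2 = r + 1 by omega, List.cons_append,
      List.nil_append] at hy
    rw [hcons, hpw, hsum, (hwa _ h₀.1 h₀.2).1, (hwa _ h₁.1 h₁.2).2, hy]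
    linarith
end

section
/- Let n ≥ 4, let G be a weighted complete graph on [n] with edge-weight function w, and let i, j, k ∈ [n] be pairwise distinct. Then there exists a bijection f from the set of simple paths between i and k onto the set of simple paths between j and k such that the multiset { w(p) − w(f(p)) : p a simple path between i and k } equals the multiset consisting of: one cop: w({i,k}) − w({j,k}); N_{n−1} copies of −( w({i,k}) − w({j,k}) ); and, for each r ∈ [n] ∖ {i,j,k}, N_{n−2} copies of w({i,r}) − w({j,r}) and N_{n−1} − N_{n−2} copies of −( w({i,r}) − w({j,r}) ). -/
open Finset

theorem mem_pathFinset {n : ℕ} {i j : Fin n} {p : List (Fin n)} :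
    p ∈ pathFinset n i j ↔ IsPath i j p := by
  simp [pathFinset]

/-- The simple paths between `u` and `v` all of whose vertices avoid `S`. -/
noncomputable def avoidingPaths {n : ℕ} (S : Finset (Fin n)) (u v : Fin n) :
    Finset (List (Fin n)) :=
  {p ∈ pathFinset n u v | ∀ x ∈ p, x ∉ S}

theorem mem_avoidingPaths {n : ℕ} {S : Finset (Fin n)} {u v : Fin n} {p : List (Fin n)} :
    p ∈ avoidingPaths S u v ↔ IsPath u v p ∧ ∀ x ∈ p, x ∉ S := by
  simp [avoidingPaths, mem_pathFinset]

theorem isPath_cons_cons {n : ℕ} {u v a b : Fin n} {l : List (Fin n)} :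
    IsPath u v (a :: b :: l) ↔ a = u ∧ a ∉ b :: l ∧ IsPath b v (b :: l) := by
  simp only [IsPath, List.nodup_cons, List.head?_cons, List.getLast?_cons_cons, Option.some.injEq]
  tauto

theorem IsPath.exists_eq_cons_cons {n : ℕ} {u v : Fin n} {p : List (Fin n)} (hp : IsPath u v p)
    (huv : u ≠ v) : ∃ b l, p = u :: b :: l := by
  obtain ⟨-, h1, h2⟩ := hp
  match p with
  | [] => simp at h1
  | [a] => simp_all
  | a :: b :: l => simp_all

theorem isPath_self_iff {n : ℕ} {v : Fin n} {p : List (Fin n)} : IsPath v v p ↔ p = [v] := by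
  constructor
  · rintro ⟨h0, h1, h2⟩
    match p with
    | [] => simp at h1
    | [a] => simp_all
    | a :: b :: l =>
      have : a ∈ b :: l := by
        apply List.mem_of_getLast?
        rw [List.getLast?_cons_cons] at h2
        simp_all
      simp_all
  · rintro rfl
    simp [IsPath]

theorem Nn_add_two (m : ℕ) : Nn (m + 2) = ∑ l ∈ range (m + 1), m.descFactorial l := by
  have : Icc 1 (m + 2 - 1) = Ico (0 + 1) (m + 1 + 1) := by ext; simp only [mem_Icc, mem_Ico]; omega
  rw [Nn, this, range_eq_Ico, ← Finset.sum_Ico_add']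
  refine sum_congr rfl fun k hk => ?_
  rw [Nat.descFactorial_eq_div (by simp at hk; omega)]
  congr 2
  omega

theorem Nn_add_three (m : ℕ) : Nn (m + 3) = 1 + (m + 1) * Nn (m + 2) := by
  rw [Nn_add_two, Nn_add_two, sum_range_succ', mul_sum, add_comm]
  simp only [Nat.succ_descFactorial_succ, Nat.descFactorial_zero]

theorem card_avoidingPaths_cons {n : ℕ} {S : Finset (Fin n)} {u v r : Fin n} (huS : u ∉ S):
    #{p ∈ avoidingPaths S u v | [u, r] <+: p} = #(avoidingPaths (insert u S) r v) := by
  symm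
  refine card_nbij' (List.cons u) List.tail ?_ ?_ ?_ ?_
  · intro q hq
    simp only [coe_filter, Set.mem_ofPred_eq, mem_coe, mem_avoidingPaths] at hq ⊢
    obtain ⟨hq, h⟩ := hq
    match q with
    | [] => simp [IsPath] at hq
    | a :: l =>
      have : a = r := by simpa using hq.2.1
      subst this
      refine ⟨⟨isPath_cons_cons.2 ⟨rfl, fun h' => by simpa using h u h', hq⟩, ?_⟩, l, rfl⟩
      intro x hx
      rcases List.mem_cons.1 hx with rfl | hx
      · exact huS
      · exact fun h' => h x hx (mem_insert_of_mem h')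
  · intro p hp
    simp only [coe_filter, Set.mem_ofPred_eq, mem_coe, mem_avoidingPaths] at hp ⊢
    obtain ⟨⟨hp, h⟩, l, rfl⟩ := hp
    obtain ⟨-, h1, h2⟩ := isPath_cons_cons.1 hp
    refine ⟨h2, fun x hx => ?_⟩
    simp only [mem_insert, not_or]
    exact ⟨fun e => h1 (e ▸ hx), h x (List.mem_cons_of_mem _ hx)⟩
  · intro q _; rfl
  · intro p hp
    simp only [coe_filter, Set.mem_ofPred_eq] at hp
    obtain ⟨-, l, rfl⟩ := hp
    rfl

theorem avoidingPaths_self {n : ℕ} {S : Finset (Fin n)} {v : Fin n} (hv : v ∉ S) :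
    avoidingPaths S v v = {[v]} := by
  ext p
  simp only [mem_avoidingPaths, isPath_self_iff, mem_singleton]
  constructor
  · exact fun h => h.1
  · rintro rfl
    simpa using hv

theorem card_avoidingPaths_eq_sum {n : ℕ} {S : Finset (Fin n)} {u v : Fin n} (huv : u ≠ v)
    (hu : u ∉ S) (hv : v ∉ S) :
    #(avoidingPaths S u v) =
      1 + ∑ r ∈ (insert u S)ᶜ.erase v, #(avoidingPaths (insert u S) r v) := by
  have hvm : v ∈ (insert u S)ᶜ := by simp [huv.symm, hv]
  rw [card_eq_sum_card_fiberwise (f := fun p => p.tail.headD u) (t := (insert u S)ᶜ)]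
  · have : 1 = #(avoidingPaths (insert u S) v v) := by
      rw [avoidingPaths_self (by simpa using hvm), card_singleton]
    rw [this, add_sum_erase _ (fun r => #(avoidingPaths (insert u S) r v)) hvm]
    refine sum_congr rfl fun r hr => ?_
    rw [← card_avoidingPaths_cons hu]
    congr 1
    refine filter_congr fun p hp => ?_
    obtain ⟨b, l, rfl⟩ := (mem_avoidingPaths.1 hp).1.exists_eq_cons_cons huv
    simp [eq_comm]
  · intro p hp
    obtain ⟨h1, h2⟩ := mem_avoidingPaths.1 (mem_coe.1 hp)
    obtain ⟨b, l, rfl⟩ := h1.exists_eq_cons_cons huv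
    have h3 := (isPath_cons_cons.1 h1).2.1
    have h4 : b ≠ u := fun e => h3 (by simp [e])
    simp [h4, h2 b]

theorem card_avoidingPaths {n : ℕ} (m : ℕ) {S : Finset (Fin n)} {u v : Fin n} (huv : u ≠ v)
    (hu : u ∉ S) (hv : v ∉ S) (hm : #S + (m + 2) = n) :
    #(avoidingPaths S u v) = Nn (m + 2) := by
  have hvm : v ∈ (insert u S)ᶜ := by simp [huv.symm, hv]
  have hcard : #((insert u S)ᶜ.erase v) = m := by
    rw [card_erase_of_mem hvm, card_compl, Fintype.card_fin, card_insert_of_notMem hu]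
    omega
  rw [card_avoidingPaths_eq_sum huv hu hv]
  induction m generalizing S u with
  | zero =>
    rw [card_eq_zero] at hcard
    rw [hcard]
    simp [Nn]
  | succ m ih =>
    rw [Nn_add_three, sum_const_nat (m := Nn (m + 2)), hcard]
    intro r hr
    simp only [mem_erase, mem_compl] at hr
    have hv' : v ∉ insert u S := by simpa using hvm
    have hvm' : v ∈ (insert r (insert u S))ᶜ := by
      rw [mem_compl, mem_insert, not_or]
      exact ⟨hr.1.symm, hv'⟩
    rw [card_avoidingPaths_eq_sum hr.1 hr.2 hv']
    have hc : #(insert u S) + (m + 2) = n := by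
      rw [card_insert_of_notMem hu]; omega
    refine ih hr.1 hr.2 hv' hc hvm' ?_
    rw [card_erase_of_mem hvm', card_compl, Fintype.card_fin, card_insert_of_notMem hr.2]
    omega

/-- The vertex following the first occurrence of `a` in the list `p`. -/
def nextAfter {n : ℕ} (a : Fin n) (p : List (Fin n)) : Fin n :=
  (p.dropWhile (· ≠ a)).tail.headD a

/-- Turns a path starting at `i` into one starting at `j`: if the path passes through `j`, its
segment from `i` to `j` is reversed, and otherwise its first vertex is replaced by `j`. -/
def redirect {n : ℕ} (i j : Fin n) (p : List (Fin n)) : List (Fin n) :=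
  if j ∈ p then j :: (p.tail.takeWhile (· ≠ j)).reverse ++ i :: (p.dropWhile (· ≠ j)).tail
  else j :: p.tail

theorem dropWhile_ne_append_cons {α : Type*} [DecidableEq α] {a : α} {l t : List α} (h : a ∉ l) :
    (l ++ a :: t).dropWhile (· ≠ a) = a :: t := by
  induction l with
  | nil => simp
  | cons b l ih =>
    simp only [List.mem_cons, not_or] at h
    simpa [Ne.symm h.1] using ih h.2

theorem takeWhile_ne_append_cons {α : Type*} [DecidableEq α] {a : α} {l t : List α} (h : a ∉ l) :
    (l ++ a :: t).takeWhile (· ≠ a) = l := by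
  induction l with
  | nil => simp
  | cons b l ih =>
    simp only [List.mem_cons, not_or] at h
    simpa [Ne.symm h.1] using ih h.2

theorem nextAfter_append {n : ℕ} {a b : Fin n} {l t : List (Fin n)} (h : a ∉ l) :
    nextAfter a (l ++ a :: b :: t) = b := by
  rw [nextAfter, dropWhile_ne_append_cons h]
  rfl

theorem nextAfter_cons_cons {n : ℕ} {a b : Fin n} {t : List (Fin n)} :
    nextAfter a (a :: b :: t) = b :=
  nextAfter_append (l := []) (by simp)

theorem redirect_append {n : ℕ} {i j : Fin n} {l t : List (Fin n)} (hij : i ≠ j) (h : j ∉ l) :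
    redirect i j (i :: (l ++ j :: t)) = j :: (l.reverse ++ i :: t) := by
  have h' : j ∉ i :: l := by simp [h, hij.symm]
  have := dropWhile_ne_append_cons (t := t) h'
  rw [List.cons_append] at this
  rw [redirect, if_pos (by simp), List.tail_cons, takeWhile_ne_append_cons h, this]
  rfl

theorem redirect_of_notMem {n : ℕ} {i j : Fin n} {p : List (Fin n)} (h : j ∉ p) :
    redirect i j p = j :: p.tail :=
  if_neg h

theorem pathWeight_append_cons {n : ℕ} (w : Fin n → Fin n → ℝ) (l t : List (Fin n)) (v : Fin n) :
    pathWeight w (l ++ v :: t) = pathWeight w (l ++ [v]) + pathWeight w (v :: t) := by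
  induction l with
  | nil => simp [pathWeight]
  | cons a l ih =>
    cases l with
    | nil => simp [pathWeight]
    | cons b l =>
      simp only [List.cons_append, pathWeight] at ih ⊢
      rw [ih, add_assoc]

theorem pathWeight_reverse {n : ℕ} {w : Fin n → Fin n → ℝ} (hw : ∀ a b, w a b = w b a)
    (l : List (Fin n)) : pathWeight w l.reverse = pathWeight w l := by
  induction l with
  | nil => rfl
  | cons a l ih =>
    cases l with
    | nil => rfl
    | cons b l =>
      rw [List.reverse_cons, List.reverse_cons, List.append_assoc, List.singleton_append,
        pathWeight_append_cons, ← List.reverse_cons, ih, add_comm]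
      simp [pathWeight, hw a b]

theorem isPath_append_cons_cons {n : ℕ} {i j k b : Fin n} {l t : List (Fin n)} :
    IsPath i k (i :: (l ++ j :: b :: t)) ↔
      (i :: (l ++ j :: b :: t)).Nodup ∧ (b :: t).getLast? = some k := by
  rw [IsPath, ← List.cons_append, List.getLast?_append_cons, List.getLast?_cons_cons]
  simp

theorem IsPath.exists_eq_append {n : ℕ} {i j k : Fin n} {p : List (Fin n)} (hp : IsPath i k p)
    (hij : i ≠ j) (hjk : j ≠ k) (hj : j ∈ p) :
    ∃ l b t, p = i :: (l ++ j :: b :: t) ∧ (i :: (l ++ j :: b :: t)).Nodup ∧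
      (b :: t).getLast? = some k := by
  obtain ⟨s, t, rfl⟩ := List.append_of_mem hj
  cases s with
  | nil => exact absurd hp.2.1 (by simpa using hij.symm)
  | cons a s =>
    cases t with
    | nil => exact absurd hp.2.2 (by rw [List.getLast?_append_cons]; simpa using hjk)
    | cons b t =>
      obtain rfl : a = i := by simpa using hp.2.1
      exact ⟨s, b, t, rfl, isPath_append_cons_cons.1 hp⟩

theorem IsPath.redirect {n : ℕ} {i j k : Fin n} {p : List (Fin n)} (hp : IsPath i k p)
    (hij : i ≠ j) (hik : i ≠ k) (hjk : j ≠ k) : IsPath j k (redirect i j p) := by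
  by_cases hj : j ∈ p
  · obtain ⟨l, b, t, rfl, hnd, hl⟩ := hp.exists_eq_append hij hjk hj
    have hjl : j ∉ l := by grind
    rw [redirect_append hij hjl, isPath_append_cons_cons]
    refine ⟨?_, hl⟩
    rw [List.nodup_cons, List.nodup_append] at hnd ⊢
    simp only [List.nodup_reverse, List.mem_append, List.mem_reverse, List.mem_cons,
      List.nodup_cons] at hnd ⊢
    grind
  · obtain ⟨b, t, rfl⟩ := hp.exists_eq_cons_cons hik
    rw [redirect_of_notMem hj]
    rw [isPath_cons_cons] at hp
    exact isPath_cons_cons.2 ⟨rfl, by grind, hp.2.2⟩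

theorem IsPath.redirect_redirect {n : ℕ} {i j k : Fin n} {p : List (Fin n)} (hp : IsPath i k p)
    (hij : i ≠ j) (hik : i ≠ k) (hjk : j ≠ k) :
    _root_.redirect j i (_root_.redirect i j p) = p := by
  by_cases hj : j ∈ p
  · obtain ⟨l, b, t, rfl, hnd, hl⟩ := hp.exists_eq_append hij hjk hj
    have hjl : j ∉ l := by grind
    have hil : i ∉ l.reverse := by grind
    rw [redirect_append hij hjl, redirect_append hij.symm hil, List.reverse_reverse]
  · obtain ⟨b, t, rfl⟩ := hp.exists_eq_cons_cons hik
    rw [isPath_cons_cons] at hp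
    have hi : i ∉ j :: b :: t := by grind
    rw [redirect_of_notMem hj, List.tail_cons, redirect_of_notMem hi, List.tail_cons]

theorem bijOn_redirect {n : ℕ} {i j k : Fin n} (hij : i ≠ j) (hik : i ≠ k) (hjk : j ≠ k) :
    Set.BijOn (redirect i j) {p | IsPath i k p} {p | IsPath j k p} :=
  Set.InvOn.bijOn (f' := redirect j i)
    ⟨fun _ hp => IsPath.redirect_redirect hp hij hik hjk,
      fun _ hp => IsPath.redirect_redirect hp hij.symm hjk hik⟩
    (fun _ hp => IsPath.redirect hp hij hik hjk)
    (fun _ hp => IsPath.redirect hp hij.symm hjk hik)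

theorem IsPath.pathWeight_sub_redirect_of_mem {n : ℕ} {w : Fin n → Fin n → ℝ}
    (hw : ∀ a b, w a b = w b a) {i j k : Fin n} {p : List (Fin n)} (hp : IsPath i k p)
    (hij : i ≠ j) (hjk : j ≠ k) (hj : j ∈ p) :
    pathWeight w p - pathWeight w (_root_.redirect i j p) =
      -(w i (nextAfter j p) - w j (nextAfter j p)) := by
  obtain ⟨l, b, t, rfl, hnd, -⟩ := hp.exists_eq_append hij hjk hj
  have hjl : j ∉ l := by grind
  have hjl' : j ∉ i :: l := by grind
  have hrev : pathWeight w (j :: (l.reverse ++ [i])) = pathWeight w (i :: (l ++ [j])) := by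
    rw [← pathWeight_reverse hw]
    simp
  rw [redirect_append hij hjl, ← List.cons_append, ← List.cons_append, nextAfter_append hjl',
    pathWeight_append_cons, pathWeight_append_cons w (j :: l.reverse), List.cons_append,
    List.cons_append, hrev]
  simp only [pathWeight]
  ring

theorem IsPath.pathWeight_sub_redirect_of_notMem {n : ℕ} (w : Fin n → Fin n → ℝ)
    {i j k : Fin n} {p : List (Fin n)} (hp : IsPath i k p) (hik : i ≠ k) (hj : j ∉ p) :
    pathWeight w p - pathWeight w (_root_.redirect i j p) =
      w i (nextAfter i p) - w j (nextAfter i p) := by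
  obtain ⟨b, t, rfl⟩ := hp.exists_eq_cons_cons hik
  rw [redirect_of_notMem hj, nextAfter_cons_cons]
  simp only [List.tail_cons, pathWeight]
  ring

theorem card_filter_nextAfter_of_notMem {n : ℕ} {i j k r : Fin n} (hij : i ≠ j) (hik : i ≠ k) :
    #{p ∈ pathFinset n i k | j ∉ p ∧ nextAfter i p = r} = #(avoidingPaths {i, j} r k) := by
  rw [← card_avoidingPaths_cons (by simpa using hij), avoidingPaths, filter_filter]
  congr 1
  refine filter_congr fun p hp => ?_
  obtain ⟨b, t, rfl⟩ := (mem_pathFinset.1 hp).exists_eq_cons_cons hik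
  rw [nextAfter_cons_cons]
  refine and_congr ?_ (by simp [eq_comm])
  simp only [mem_singleton]
  exact ⟨fun h x hx e => h (e ▸ hx), fun h hx => h j hx rfl⟩

theorem flatMap_insert_before {α : Type*} [DecidableEq α] {a b : α} {l t : List α}
    (hl : b ∉ l) (ht : b ∉ t) :
    (l ++ b :: t).flatMap (fun x => if x = b then [a, b] else [x]) = l ++ a :: b :: t := by
  have aux : ∀ l : List α, b ∉ l → l.flatMap (fun x => if x = b then [a, b] else [x]) = l := by
    intro l hl
    induction l with
    | nil => rfl
    | cons c l ih => grind
  rw [List.flatMap_append, List.flatMap_cons, aux l hl, aux t ht, if_pos rfl]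
  rfl

theorem card_filter_nextAfter_of_mem {n : ℕ} {i j k r : Fin n} (hij : i ≠ j) (hjk : j ≠ k)
    (hri : r ≠ i) :
    #{p ∈ pathFinset n i k | j ∈ p ∧ nextAfter j p = r} =
      #{p ∈ avoidingPaths {j} i k | r ∈ p} := by
  refine card_nbij' (fun p => p.erase j) (fun q => q.flatMap fun x => if x = r then [j, r] else [x])
    ?_ ?_ ?_ ?_
  · intro p hp
    simp only [coe_filter, Set.mem_ofPred_eq, mem_pathFinset, mem_avoidingPaths] at hp ⊢
    obtain ⟨hp, hj, h⟩ := hp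
    obtain ⟨l, b, t, rfl, hnd, hl⟩ := hp.exists_eq_append hij hjk hj
    have hjl : j ∉ i :: l := by grind
    rw [← List.cons_append, nextAfter_append hjl] at h
    subst h
    rw [← List.cons_append, List.erase_append_right _ hjl, List.erase_cons_head]
    refine ⟨⟨⟨by grind, by simp, by rwa [List.getLast?_append_cons]⟩, ?_⟩, by simp⟩
    intro x hx
    rw [mem_singleton]
    grind
  · intro q hq
    simp only [coe_filter, Set.mem_ofPred_eq, mem_pathFinset, mem_avoidingPaths] at hq ⊢
    obtain ⟨⟨hq, h⟩, hr⟩ := hq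
    have hjq : j ∉ q := fun hx => h j hx (mem_singleton_self j)
    obtain ⟨s, t, rfl⟩ := List.append_of_mem hr
    cases s with
    | nil => exact absurd hq.2.1 (by simpa using hri)
    | cons a s =>
      obtain rfl : a = i := by simpa using hq.2.1
      have hnd := hq.1
      have hl := hq.2.2
      rw [List.getLast?_append_cons] at hl
      rw [flatMap_insert_before (by grind) (by grind)]
      refine ⟨?_, by simp, nextAfter_append (by grind)⟩
      exact isPath_append_cons_cons.2 ⟨by grind, hl⟩
  · intro p hp
    simp only [coe_filter, Set.mem_ofPred_eq, mem_pathFinset] at hp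
    obtain ⟨hp, hj, h⟩ := hp
    obtain ⟨l, b, t, rfl, hnd, hl⟩ := hp.exists_eq_append hij hjk hj
    have hjl : j ∉ i :: l := by grind
    rw [← List.cons_append, nextAfter_append hjl] at h
    subst h
    simp only [← List.cons_append]
    rw [List.erase_append_right _ hjl, List.erase_cons_head,
      flatMap_insert_before (by grind) (by grind)]
  · intro q hq
    simp only [coe_filter, Set.mem_ofPred_eq, mem_avoidingPaths] at hq
    obtain ⟨⟨hq, h⟩, hr⟩ := hq
    have hjq : j ∉ q := fun hx => h j hx (mem_singleton_self j)
    obtain ⟨s, t, rfl⟩ := List.append_of_mem hr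
    have hnd := hq.1
    simp only
    rw [flatMap_insert_before (by grind) (by grind), List.erase_append_right _ (by grind)]
    simp

theorem filter_mem_avoidingPaths_end {n : ℕ} {S : Finset (Fin n)} {u v : Fin n} :
    {p ∈ avoidingPaths S u v | v ∈ p} = avoidingPaths S u v :=
  filter_true_of_mem fun _ hp => List.mem_of_getLast? (mem_avoidingPaths.1 hp).1.2.2

theorem card_filter_mem_avoidingPaths {n : ℕ} {j r u v : Fin n} :
    #{p ∈ avoidingPaths {j} u v | r ∈ p} =
      #(avoidingPaths {j} u v) - #(avoidingPaths {j, r} u v) := by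
  rw [← card_filter_add_card_filter_not (s := avoidingPaths {j} u v) (fun p => r ∈ p)]
  have : {p ∈ avoidingPaths {j} u v | ¬ r ∈ p} = avoidingPaths {j, r} u v := by
    ext p
    simp only [mem_filter, mem_avoidingPaths, mem_insert, mem_singleton, not_or]
    grind
  rw [this, Nat.add_sub_cancel]

theorem map_val_eq_sum_replicate {α β κ : Type*} [DecidableEq κ] (s : Finset α) (t : Finset κ)
    (g : α → κ) (d : α → β) (D : κ → β) (hg : ∀ a ∈ s, g a ∈ t) (hd : ∀ a ∈ s, d a = D (g a)) :
    s.val.map d = ∑ x ∈ t, Multiset.replicate #{a ∈ s | g a = x} (D x) := by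
  have : s.val.map d = ∑ a ∈ s, {d a} := by
    change _ = (s.val.map (singleton ∘ d)).sum
    rw [← Multiset.map_map]
    exact (Multiset.sum_map_singleton _).symm
  rw [this, ← sum_fiberwise_of_maps_to hg]
  refine sum_congr rfl fun x _ => ?_
  rw [sum_congr rfl (g := fun _ => {D x}) fun a ha => by
    rw [mem_filter] at ha; rw [hd a ha.1, ha.2]]
  rw [sum_const, Multiset.nsmul_singleton]

/-- There is a bijection `f` from the simple paths between `i` and `k` onto the
simple paths between `j` and `k` such that the multiset `{w(p) - w(f(p))}` consists of one copy
of `w({i,k}) - w({j,k})`, `N_{n-1}` copies of its opposite, and for each `r ∈ [n] ∖ {i,j,k}`,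
`N_{n-2}` copies of `w({i,r}) - w({j,r})` and `N_{n-1} - N_{n-2}` copies of its opposite. -/
theorem stmt_13 (n : ℕ) (hn : 4 ≤ n) (w : Fin n → Fin n → ℝ) (hw : ∀ a b, w a b = w b a)
    (i j k : Fin n) (hij : i ≠ j) (hik : i ≠ k) (hjk : j ≠ k) :
    ∃ f : List (Fin n) → List (Fin n),
      Set.BijOn f {p : List (Fin n) | IsPath i k p} {p : List (Fin n) | IsPath j k p} ∧
      (pathFinset n i k).val.map (fun p => pathWeight w p - pathWeight w (f p)) =
        ({w i k - w j k} : Multiset ℝ)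
        + Multiset.replicate (Nn (n - 1)) (-(w i k - w j k))
        + (Finset.filter (fun r : Fin n => r ≠ i ∧ r ≠ j ∧ r ≠ k) Finset.univ).val.bind
            (fun r => Multiset.replicate (Nn (n - 2)) (w i r - w j r)
              + Multiset.replicate (Nn (n - 1) - Nn (n - 2)) (-(w i r - w j r))) := by
  refine ⟨redirect i j, bijOn_redirect hij hik hjk, ?_⟩
  obtain ⟨m, rfl⟩ : ∃ m, n = m + 4 := ⟨n - 4, by omega⟩
  set R := Finset.filter (fun r : Fin (m + 4) => r ≠ i ∧ r ≠ j ∧ r ≠ k) Finset.univ with hR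
  have hkR : k ∉ R := by simp [hR]
  have hmem : ∀ x, x ∈ insert k R ↔ x ≠ i ∧ x ≠ j := by
    intro x
    by_cases hx : x = k
    · simp [hx, hik.symm, hjk.symm]
    · simp [hR, hx]
  have hcardk : #(avoidingPaths {j} i k) = Nn (m + 4 - 1) :=
    card_avoidingPaths (m + 1) hik (by simpa using hij) (by simpa using hjk.symm) (by simp; omega)
  have hcardr : ∀ r ∈ R, #(avoidingPaths {i, j} r k) = Nn (m + 4 - 2) := by
    intro r hr
    simp only [hR, mem_filter, mem_univ, true_and] at hr
    refine card_avoidingPaths m hr.2.2 (by simp [hr]) (by simp [hik.symm, hjk.symm]) ?_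
    rw [card_pair hij]
    omega
  have hcardr' : ∀ r ∈ R, #(avoidingPaths {j, r} i k) = Nn (m + 4 - 2) := by
    intro r hr
    simp only [hR, mem_filter, mem_univ, true_and] at hr
    refine card_avoidingPaths m hik (by simp [hij, hr.1.symm]) (by simp [hjk.symm, hr.2.2.symm]) ?_
    rw [card_pair hr.2.1.symm]
    omega
  have hnot : {p ∈ pathFinset (m + 4) i k | j ∉ p}.val.map
      (fun p => pathWeight w p - pathWeight w (redirect i j p)) =
      {w i k - w j k} + ∑ r ∈ R, Multiset.replicate (Nn (m + 4 - 2)) (w i r - w j r) := by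
    rw [map_val_eq_sum_replicate _ (insert k R) (nextAfter i) _ (fun r => w i r - w j r),
      sum_insert hkR]
    · congr 1
      · rw [filter_filter, card_filter_nextAfter_of_notMem hij hik,
          avoidingPaths_self (by simp [hik.symm, hjk.symm]), card_singleton,
          Multiset.replicate_one]
      · refine sum_congr rfl fun r hr => ?_
        rw [filter_filter, card_filter_nextAfter_of_notMem hij hik, hcardr r hr]
    · intro p hp
      rw [mem_filter, mem_pathFinset] at hp
      obtain ⟨hp, hj⟩ := hp
      obtain ⟨b, t, rfl⟩ := hp.exists_eq_cons_cons hik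
      have := hp.1
      rw [nextAfter_cons_cons, hmem]
      grind
    · intro p hp
      rw [mem_filter, mem_pathFinset] at hp
      exact hp.1.pathWeight_sub_redirect_of_notMem w hik hp.2
  have hin : {p ∈ pathFinset (m + 4) i k | j ∈ p}.val.map
      (fun p => pathWeight w p - pathWeight w (redirect i j p)) =
      Multiset.replicate (Nn (m + 4 - 1)) (-(w i k - w j k)) +
        ∑ r ∈ R, Multiset.replicate (Nn (m + 4 - 1) - Nn (m + 4 - 2)) (-(w i r - w j r)) := by
    rw [map_val_eq_sum_replicate _ (insert k R) (nextAfter j) _ (fun r => -(w i r - w j r)),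
      sum_insert hkR]
    · congr 1
      · rw [filter_filter, card_filter_nextAfter_of_mem hij hjk hik.symm,
          filter_mem_avoidingPaths_end, hcardk]
      · refine sum_congr rfl fun r hr => ?_
        have hri : r ≠ i := by simp only [hR, mem_filter] at hr; exact hr.2.1
        rw [filter_filter, card_filter_nextAfter_of_mem hij hjk hri,
          card_filter_mem_avoidingPaths, hcardk, hcardr' r hr]
    · intro p hp
      rw [mem_filter, mem_pathFinset] at hp
      obtain ⟨hp, hj⟩ := hp
      obtain ⟨l, b, t, rfl, hnd, -⟩ := hp.exists_eq_append hij hjk hj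
      rw [← List.cons_append, nextAfter_append (by grind), hmem]
      grind
    · intro p hp
      rw [mem_filter, mem_pathFinset] at hp
      exact hp.1.pathWeight_sub_redirect_of_mem hw hij hjk hp.2
  have hsum : R.val.bind (fun r => Multiset.replicate (Nn (m + 4 - 2)) (w i r - w j r)
      + Multiset.replicate (Nn (m + 4 - 1) - Nn (m + 4 - 2)) (-(w i r - w j r))) =
      ∑ r ∈ R, Multiset.replicate (Nn (m + 4 - 2)) (w i r - w j r) +
        ∑ r ∈ R, Multiset.replicate (Nn (m + 4 - 1) - Nn (m + 4 - 2)) (-(w i r - w j r)) := by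
    rw [← sum_add_distrib]
    rfl
  rw [hsum, ← Multiset.filter_add_not (fun p => j ∈ p) (pathFinset (m + 4) i k).val,
    Multiset.map_add, ← filter_val, ← filter_val, hin, hnot]
  abel
end
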